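/- arXiv:2510.19216 — 2 statements merged into one kernel-verified Lean document; each statement's English description precedes it below -/
import Mathlib

section
/- Let F ⊆ ℕ be finite and let p, q be Cohen conditions that agree on (F × ℕ) ∩ dom(p) ∩ dom(q). Then there exists a finitary permutation π of ℕ whose support is disjoint from F such that the conditions π·p and q are compatible. -/
/-- The permutation group of `ℕ` acts on Cohen conditions (functions
`ℕ × ℕ → Option Bool` with finite domain) via the first coordinate:
`(π · p)(n, m) = p(π⁻¹ n, m)`. -/
def permActCohen (π : Equiv.Perm ℕ) (p : ℕ × ℕ → Option Bool) : ℕ × ℕ → Option Bool :=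
  fun x => p (π⁻¹ x.1, x.2)

/-- The involution exchanging `n` and `n + N` for every `n < N` outside `F`. -/
noncomputable def shiftOff (F : Set ℕ) (N n : ℕ) : ℕ :=
  open Classical in
  if n < N ∧ n ∉ F then n + N
  else if N ≤ n ∧ n < 2 * N ∧ n - N ∉ F then n - N
  else n

lemma shiftOff_of_notMem {F : Set ℕ} {N n : ℕ} (hn : n < N) (hF : n ∉ F) :
    shiftOff F N n = n + N := by
  simp [shiftOff, hn, hF]

lemma shiftOff_of_mem {F : Set ℕ} {N n : ℕ} (hn : n < N) (hF : n ∈ F) :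
    shiftOff F N n = n := by
  simp [shiftOff, hF, hn.not_ge]

lemma shiftOff_of_le {F : Set ℕ} {N n : ℕ} (hn : 2 * N ≤ n) : shiftOff F N n = n := by
  rw [shiftOff, if_neg (by omega), if_neg (by omega)]

lemma shiftOff_involutive (F : Set ℕ) (N : ℕ) : Function.Involutive (shiftOff F N) := by
  intro n
  by_cases h₁ : n < N ∧ n ∉ F
  · rw [shiftOff_of_notMem h₁.1 h₁.2, shiftOff, if_neg (by omega), if_pos, Nat.add_sub_cancel]
    exact ⟨by omega, by omega, by simpa using h₁.2⟩
  by_cases h₂ : N ≤ n ∧ n < 2 * N ∧ n - N ∉ F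
  · have h : shiftOff F N n = n - N := by rw [shiftOff, if_neg h₁, if_pos h₂]
    rw [h, shiftOff_of_notMem (by omega) h₂.2.2]
    omega
  · have h : shiftOff F N n = n := by rw [shiftOff, if_neg h₁, if_neg h₂]
    rw [h, h]

/-- If `F ⊆ ℕ` is finite and the Cohen conditions `p, q` agree on
`(F × ℕ) ∩ dom p ∩ dom q`, then there is a finitary permutation `π` of `ℕ` with
support disjoint from `F` such that `π · p` and `q` are compatible. -/
theorem cohen_homogeneity_off_finite_support
    (F : Set ℕ) (hF : F.Finite)
    (p q : ℕ × ℕ → Option Bool)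
    (hp : {x : ℕ × ℕ | p x ≠ none}.Finite)
    (hq : {x : ℕ × ℕ | q x ≠ none}.Finite)
    (hagree : ∀ x : ℕ × ℕ, x.1 ∈ F → p x ≠ none → q x ≠ none → p x = q x) :
    ∃ π : Equiv.Perm ℕ,
      {n : ℕ | π n ≠ n}.Finite ∧
      Disjoint {n : ℕ | π n ≠ n} F ∧
      ∀ x : ℕ × ℕ, permActCohen π p x ≠ none → q x ≠ none → permActCohen π p x = q x := by
  obtain ⟨N, hN⟩ := ((hF.union (hp.image Prod.fst)).union (hq.image Prod.fst)).bddAbove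
  have hFN : ∀ n ∈ F, n < N + 1 := fun n hn => Nat.lt_succ_of_le (hN (.inl (.inl hn)))
  have hpN : ∀ x, p x ≠ none → x.1 < N + 1 := fun x hx =>
    Nat.lt_succ_of_le (hN (.inl (.inr ⟨x, hx, rfl⟩)))
  have hqN : ∀ x, q x ≠ none → x.1 < N + 1 := fun x hx =>
    Nat.lt_succ_of_le (hN (.inr ⟨x, hx, rfl⟩))
  refine ⟨(shiftOff_involutive F (N + 1)).toPerm, ?_, ?_, ?_⟩
  · refine (Set.finite_lt_nat (2 * (N + 1))).subset fun n hn => ?_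
    by_contra h
    exact hn (shiftOff_of_le (not_lt.mp h))
  · exact Set.disjoint_left.mpr fun n hn hnF => hn (shiftOff_of_mem (hFN n hnF) hnF)
  · intro x hpx hqx
    change p (shiftOff F (N + 1) x.1, x.2) ≠ none at hpx
    change p (shiftOff F (N + 1) x.1, x.2) = q x
    by_cases hx : x.1 ∈ F
    · rw [shiftOff_of_mem (hFN _ hx) hx] at hpx ⊢
      exact hagree x hx hpx hqx
    · have h := hpN _ hpx
      rw [shiftOff_of_notMem (hqN x hqx) hx] at h
      omega
end

section
/- Let K be a finite subgroup of the permutation group of ℕ and let s be a Cohen condition such that for all distinct π, π' ∈ K the domains of π·s and π'·s are disjoint. Then there exists a Cohen condition q whose domain is the union over π ∈ K of the domains of π·s, such that q extends π·s for every π ∈ K, and such that q is K-invariant: π·q = q for all π ∈ K. -/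
/-- Functions with values in `Option` whose domains are pairwise disjoint have a common extension
defined exactly on the union of the domains. -/
theorem exists_union_of_disjoint_domains {ι α β : Type*} (S : Set ι) (f : ι → α → Option β)
    (hf : ∀ i ∈ S, ∀ j ∈ S, i ≠ j → Disjoint {x | f i x ≠ none} {x | f j x ≠ none}) :
    ∃ q : α → Option β, {x | q x ≠ none} = ⋃ i ∈ S, {x | f i x ≠ none} ∧
      ∀ i ∈ S, ∀ x, f i x ≠ none → q x = f i x := by
  have key : ∀ x, ∃ y : Option β,
      (y ≠ none ↔ ∃ i ∈ S, f i x ≠ none) ∧ ∀ i ∈ S, f i x ≠ none → y = f i x := by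
    intro x
    by_cases h : ∃ i ∈ S, f i x ≠ none
    · obtain ⟨i, hi, hix⟩ := h
      refine ⟨f i x, ⟨fun _ => ⟨i, hi, hix⟩, fun _ => hix⟩, fun j hj hjx => ?_⟩
      by_cases hij : i = j
      · rw [hij]
      · exact (Set.disjoint_left.mp (hf i hi j hj hij) hix hjx).elim
    · exact ⟨none, ⟨fun h' => (h' rfl).elim, fun h' => (h h').elim⟩,
        fun i hi hix => (h ⟨i, hi, hix⟩).elim⟩
  choose q hdom hext using key
  refine ⟨q, ?_, fun i hi x => hext x i hi⟩
  ext x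
  simpa using hdom x

/-- A translate of a Cohen condition has finite domain. -/
theorem permActCohen_domain_finite (π : Equiv.Perm ℕ) {p : ℕ × ℕ → Option Bool}
    (hp : {x | p x ≠ none}.Finite) : {x | permActCohen π p x ≠ none}.Finite :=
  hp.preimage (f := Prod.map (π⁻¹ : Equiv.Perm ℕ) id)
    ((π⁻¹ : Equiv.Perm ℕ).injective.prodMap Function.injective_id).injOn

/-- If `K` is a finite subgroup of `Equiv.Perm ℕ` and `s` is a Cohen
condition whose `K`-translates have pairwise disjoint domains, then there is a
Cohen condition `q` whose domain is the union of the domains of the translates,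
extending every translate `π · s` for `π ∈ K`, and which is `K`-invariant. -/
theorem amalgamation_of_disjoint_translates
    (K : Subgroup (Equiv.Perm ℕ)) (hK : (K : Set (Equiv.Perm ℕ)).Finite)
    (s : ℕ × ℕ → Option Bool) (hs : {x : ℕ × ℕ | s x ≠ none}.Finite)
    (hdisj : ∀ π ∈ K, ∀ π' ∈ K, π ≠ π' →
      Disjoint {x : ℕ × ℕ | permActCohen π s x ≠ none}
               {x : ℕ × ℕ | permActCohen π' s x ≠ none}) :
    ∃ q : ℕ × ℕ → Option Bool,
      {x : ℕ × ℕ | q x ≠ none}.Finite ∧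
      {x : ℕ × ℕ | q x ≠ none} = ⋃ π ∈ (K : Set (Equiv.Perm ℕ)), {x : ℕ × ℕ | permActCohen π s x ≠ none} ∧
      (∀ π ∈ K, ∀ x : ℕ × ℕ, permActCohen π s x ≠ none → q x = permActCohen π s x) ∧
      (∀ π ∈ K, permActCohen π q = q) := by
  obtain ⟨q, hdom, hext⟩ :=
    exists_union_of_disjoint_domains (K : Set (Equiv.Perm ℕ)) (fun π => permActCohen π s) hdisj
  refine ⟨q, ?_, hdom, hext, fun π hπ => ?_⟩
  · rw [hdom]
    exact hK.biUnion fun π _ => permActCohen_domain_finite π hs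
  have hmem : ∀ x, q x ≠ none ↔ ∃ σ ∈ K, permActCohen σ s x ≠ none := fun x => by
    simpa using Set.ext_iff.mp hdom x
  have htrans : ∀ σ x, permActCohen (π⁻¹ * σ) s (π⁻¹ x.1, x.2) = permActCohen σ s x :=
    fun σ x => by simp [permActCohen, mul_inv_rev]
  funext x
  change q (π⁻¹ x.1, x.2) = q x
  by_cases hx : q x = none
  · rw [hx]
    by_contra hne
    obtain ⟨σ, hσ, hσx⟩ := (hmem _).mp hne
    refine (hmem x).mpr ⟨π * σ, K.mul_mem hπ hσ, ?_⟩ hx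
    rwa [← htrans, inv_mul_cancel_left]
  · obtain ⟨σ, hσ, hσx⟩ := (hmem x).mp hx
    rw [hext σ hσ x hσx, ← htrans σ x]
    refine hext _ (K.mul_mem (K.inv_mem hπ) hσ) _ ?_
    rwa [htrans]
end
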